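/- arXiv:math/0409173 — 2 statements merged into one kernel-verified Lean document; each statement's English description precedes it below -/
import Mathlib

section
/- Set q = p^n a prime power. Let G₁ = F_q(x) be the rational function field and let G₂ = F_q(x, z) with z^q + z = x^{q+1} be the descent over F_q of the Hermitian function field. With 𝒫 ⊂ F_{q²} the root set of T^q + T, an F_p-basis (w₁,…,w_n) of 𝒫, and P_i, M_i the associated p-polynomials over F_q with T^q + T = M_i ⋆ P_i, define for 1 ≤ i < n the field G_{1,i} = F_q(x, t_i), where t_i = P_{n−i}(z) and M_{n−i}(t_i) = x^{q+1}. Then the full constant field of each G_{1,i} is F_q, [G_{1,i} : F_q(x)] = p^i, and G₁ ⊂ G_{1,1} ⊂ ⋯ ⊂ G_{1,n−1} ⊂ G₂. -/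
open Polynomial

theorem exists_valuationSubring_of_transcendental {F E : Type*} [Field F] [Field E] [Algebra F E]
    {x : E} (hx : Transcendental F x) :
    ∃ V : ValuationSubring E, V.valuation.IsTrivialOn F ∧ 1 < V.valuation x := by
  have hx' : x ∉ (integralClosure F E).toSubring := fun h => hx h.isAlgebraic
  have : IsIntegrallyClosedIn (integralClosure F E).toSubring E :=
    inferInstanceAs (IsIntegrallyClosedIn (integralClosure F E) E)
  obtain ⟨V, hV, hxV⟩ := Subring.exists_le_valuationSubring_of_isIntegrallyClosedIn hx'
  have key : ∀ a : F, algebraMap F E a ∈ V := fun a => hV (algebraMap_mem (integralClosure F E) a)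
  refine ⟨V, ⟨fun a ha => ?_⟩, ?_⟩
  · have h1 := (V.valuation_le_one_iff _).2 (key a)
    have h2 := (V.valuation_le_one_iff _).2 (key a⁻¹)
    have ha' : algebraMap F E a ≠ 0 := by simpa using ha
    rw [map_inv₀, map_inv₀] at h2
    have h0 : 0 < V.valuation (algebraMap F E a) := by simpa [zero_lt_iff] using ha
    exact le_antisymm h1 ((inv_le_one₀ h0).1 h2)
  · rwa [← not_le, V.valuation_le_one_iff]

theorem valuation_pow_eq_of_hermitian {E Γ : Type*} [Field E] [LinearOrderedCommGroupWithZero Γ]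
    (v : Valuation E Γ) {x z : E} {q : ℕ} (hq : 1 < q) (hx : 1 < v x)
    (h : z ^ q + z = x ^ (q + 1)) : v z ^ q = v x ^ (q + 1) := by
  have h1 : 1 < v (z ^ q + z) := by
    rw [h, map_pow]; exact one_lt_pow₀ hx (by omega)
  have hz : 1 < v z := by
    by_contra! hz
    exact h1.not_ge (v.map_add_le (by rw [map_pow]; exact pow_le_one₀ zero_le hz) hz)
  rw [← map_pow, ← map_pow, ← h, v.map_add_eq_of_lt_left]
  rw [map_pow]
  simpa using pow_lt_pow_right₀ hz hq

open IntermediateField.algebraAdjoinAdjoin in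
theorem linearIndependent_pow_of_hermitian {F E : Type*} [Field F] [Field E] [Algebra F E]
    {x z : E} (hx : Transcendental F x) {q : ℕ} (hq : 1 < q) (h : z ^ q + z = x ^ (q + 1)) :
    LinearIndependent (IntermediateField.adjoin F {x}) fun b : Fin q => z ^ (b : ℕ) := by
  classical
  obtain ⟨V, hV, hxV⟩ := exists_valuationSubring_of_transcendental hx
  set v := V.valuation
  have hz := valuation_pow_eq_of_hermitian v hq hxV h
  rw [← LinearIndependent.iff_fractionRing (R := Algebra.adjoin F {x}), Fintype.linearIndependent_iff]
  intro g hg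
  have hgx : ∀ b, ∃ f : F[X], aeval x f = (g b : E) := fun b => by
    simpa [Algebra.adjoin_singleton_eq_range_aeval] using (g b).2
  choose f hf using hgx
  by_contra! hne
  obtain ⟨b₀, hb₀⟩ := hne
  have hval : ∀ b, g b ≠ 0 → v ((g b : E) * z ^ (b : ℕ)) ^ q =
      v x ^ (q * (f b).natDegree + (q + 1) * b) := fun b hb => by
    have h0 : f b ≠ 0 := by
      rintro h0
      apply hb
      ext
      rw [← hf b, h0]; simp
    rw [map_mul, ← hf b, valuation_aeval_eq_valuation_X_pow_natDegree_of_one_lt_valuation_X x hxV h0,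
      map_pow, mul_pow, ← pow_mul, pow_right_comm, hz, ← pow_mul, ← pow_add, mul_comm q]
  obtain ⟨m, hm, hmax⟩ := (Finset.univ.filter fun b => g b ≠ 0).exists_max_image
    (fun b => v ((g b : E) * z ^ (b : ℕ))) ⟨b₀, by simpa using hb₀⟩
  simp only [Finset.mem_filter, Finset.mem_univ, true_and] at hm hmax
  have hm0 : 0 < v ((g m : E) * z ^ (m : ℕ)) := by
    rw [← pow_pos_iff (n := q) (by omega), hval m hm]
    exact pow_pos (zero_lt_one.trans hxV) _
  have := v.map_sum_eq_of_lt (s := Finset.univ) (f := fun b => (g b : E) * z ^ (b : ℕ))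
    (Finset.mem_univ m) (fun b hb => by
      by_cases hgb : g b = 0
      · simpa [hgb] using hm0
      refine lt_of_le_of_ne (hmax b hgb) fun heq => ?_
      have h2 := congrArg (· ^ q) heq
      simp only [hval b hgb, hval m hm] at h2
      have h3 := (pow_right_injective₀ (zero_lt_one.trans hxV) hxV.ne') h2
      have h4 : (b : ℕ) % q = m % q := by
        have := congrArg (· % q) h3
        simpa [add_mul, Nat.add_mod] using this
      rw [Nat.mod_eq_of_lt b.2, Nat.mod_eq_of_lt m.2] at h4
      simp [Fin.ext_iff, h4] at hb)
  have hg' : ∑ b, (g b : E) * z ^ (b : ℕ) = 0 := by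
    simpa [Algebra.smul_def] using hg
  rw [hg', map_zero] at this
  exact hm0.ne this

theorem relfinrank_sup_adjoin_simple_le {F E : Type*} [Field F] [Field E] [Algebra F E]
    (A : IntermediateField F E) {t : E} {P : A[X]} (hP : P ≠ 0) (ht : aeval t P = 0) :
    0 < A.relfinrank (A ⊔ IntermediateField.adjoin F {t}) ∧
      A.relfinrank (A ⊔ IntermediateField.adjoin F {t}) ≤ P.natDegree := by
  have h : IntermediateField.extendScalars (le_sup_left : A ≤ A ⊔ IntermediateField.adjoin F {t}) =
      IntermediateField.adjoin A {t} := by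
    apply IntermediateField.restrictScalars_injective F
    rw [IntermediateField.extendScalars_restrictScalars,
      IntermediateField.restrictScalars_adjoin_eq_sup]
  have hint : IsIntegral A t := IsAlgebraic.isIntegral ⟨P, hP, ht⟩
  rw [IntermediateField.relfinrank_eq_finrank_of_le le_sup_left, h,
    IntermediateField.adjoin.finrank hint]
  exact ⟨minpoly.natDegree_pos hint,
    natDegree_le_natDegree (minpoly.degree_le_of_ne_zero _ _ hP ht)⟩

theorem finrank_of_hermitian {F E : Type*} [Field F] [Field E] [Algebra F E]
    {x z : E} (hx : Transcendental F x) {q : ℕ} (hq : 1 < q) (h : z ^ q + z = x ^ (q + 1))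
    (hgen : IntermediateField.adjoin F {x, z} = ⊤) :
    Module.finrank (IntermediateField.adjoin F {x}) E = q := by
  set K := IntermediateField.adjoin F {x}
  have hxK : x ∈ K := IntermediateField.mem_adjoin_simple_self F x
  have hdeg : (X ^ q + X - C (⟨x, hxK⟩ ^ (q + 1)) : K[X]).natDegree = q := by
    rw [natDegree_sub_C, natDegree_add_eq_left_of_natDegree_lt] <;> simp [hq]
  have hroot : aeval z (X ^ q + X - C (⟨x, hxK⟩ ^ (q + 1)) : K[X]) = 0 := by
    simp [h, IntermediateField.algebraMap_apply]
  have hsup : K ⊔ IntermediateField.adjoin F {z} = ⊤ := by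
    rw [← IntermediateField.adjoin_union, Set.singleton_union, hgen]
  obtain ⟨h1, h2⟩ := relfinrank_sup_adjoin_simple_le K
    (ne_zero_of_natDegree_gt (hdeg.symm ▸ hq)) hroot
  rw [hsup, IntermediateField.relfinrank_top_right] at h1 h2
  have := Module.finite_of_finrank_pos h1
  refine le_antisymm (h2.trans hdeg.le) ?_
  simpa using (linearIndependent_pow_of_hermitian hx hq h).fintype_card_le_finrank

theorem mem_range_of_mem_adjoin_transcendental {F E : Type*} [Field F] [Field E] [Algebra F E]
    {x y : E} (hx : Transcendental F x) (hy : IsAlgebraic F y)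
    (hyx : y ∈ IntermediateField.adjoin F {x}) : ∃ c : F, algebraMap F E c = y := by
  obtain ⟨r, s, hrs⟩ := (IntermediateField.mem_adjoin_simple_iff F y).1 hyx
  by_cases hs : aeval x s = 0
  · exact ⟨0, by simp [hrs, hs]⟩
  let y' : algebraicClosure F E := ⟨y, mem_algebraicClosure_iff.2 hy⟩
  let φ := algebraMap F (algebraicClosure F E)
  have hzero : C y' * s.map φ - r.map φ = 0 := by
    refine (transcendental_iff.1 hx.algebraicClosure) _ ?_
    simp only [map_sub, map_mul, aeval_C, φ, aeval_map_algebraMap]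
    rw [IntermediateField.algebraMap_apply]
    simp only [y']
    rw [hrs, div_mul_cancel₀ _ hs, sub_self]
  obtain ⟨i, hi⟩ : ∃ i, s.coeff i ≠ 0 := by
    by_contra! h
    exact hs (by rw [show s = 0 from Polynomial.ext (by simpa using h), map_zero])
  have hcoeff : y * algebraMap F E (s.coeff i) = algebraMap F E (r.coeff i) := by
    have := congrArg (fun P => ((P.coeff i : algebraicClosure F E) : E)) (sub_eq_zero.1 hzero)
    simpa [φ, y'] using this
  refine ⟨r.coeff i / s.coeff i, ?_⟩
  rw [map_div₀, ← hcoeff, mul_div_cancel_right₀]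
  simpa using hi

theorem mem_range_algebraMap_of_hermitian {F E : Type*} [Field F] [Field E] [Algebra F E]
    {x z : E} (hx : Transcendental F x) {q : ℕ} (hq : 1 < q) (h : z ^ q + z = x ^ (q + 1))
    (hgen : IntermediateField.adjoin F {x, z} = ⊤) {y : E} (hy : IsAlgebraic F y) :
    ∃ c : F, algebraMap F E c = y := by
  refine mem_range_of_mem_adjoin_transcendental hx hy ?_
  set K := IntermediateField.adjoin F {x}
  let L := IntermediateField.adjoin (algebraicClosure F E) {x}
  have hKL : K ≤ L.restrictScalars F := by
    rw [IntermediateField.adjoin_simple_le_iff]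
    exact IntermediateField.mem_adjoin_simple_self _ x
  have hyL : y ∈ L := L.algebraMap_mem ⟨y, mem_algebraicClosure_iff.2 hy⟩
  have hli := linearIndependent_pow_of_hermitian hx hq h
  have hfin : Module.finrank K E = q := finrank_of_hermitian hx hq h hgen
  have : FiniteDimensional K E := Module.finite_of_finrank_pos (by rw [hfin]; omega)
  have hspan := hli.span_eq_top_of_card_eq_finrank' (by rw [Fintype.card_fin]; exact hfin.symm)
  have hymem : y ∈ Submodule.span K (Set.range fun b : Fin q => z ^ (b : ℕ)) := by
    rw [hspan]; trivial
  obtain ⟨c, hc⟩ := (Submodule.mem_span_range_iff_exists_fun K).1 hymem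
  have hli' := Fintype.linearIndependent_iff.1
    (linearIndependent_pow_of_hermitian hx.algebraicClosure hq h)
  let b₀ : Fin q := ⟨0, by omega⟩
  have := hli' (fun b => ⟨c b, hKL (c b).2⟩ - if b = b₀ then ⟨y, hyL⟩ else 0) (by
    simp only [sub_smul, Finset.sum_sub_distrib, ite_smul, zero_smul, Finset.sum_ite_eq',
      Finset.mem_univ, if_true]
    rw [sub_eq_zero]
    simpa [Algebra.smul_def, b₀, IntermediateField.algebraMap_apply] using hc) b₀
  have h2 : (c b₀ : E) = y := by
    simpa [sub_eq_zero] using congrArg (fun w : L => (w : E)) this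
  rw [← h2]
  exact (c b₀).2

theorem prod_X_sub_C_eq_of_forall_eval_eq_zero {L : Type*} [Field L] {s : Finset L} {Q : L[X]}
    (hQ : Q.Monic) (hdeg : Q.natDegree = s.card) (hroot : ∀ a ∈ s, Q.eval a = 0) :
    ∏ a ∈ s, (X - C a) = Q := by
  have hmon : (∏ a ∈ s, (X - C a)).Monic := monic_prod_X_sub_C id s
  have hdeg' : (∏ a ∈ s, (X - C a)).degree = (s.card : WithBot ℕ) := by
    simp [degree_prod]
  refine eq_of_degree_sub_lt_of_eval_finset_eq s ?_ fun a ha => ?_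
  · rw [← hdeg']
    refine degree_sub_lt_left ?_ hmon.ne_zero (hmon.leadingCoeff.trans hQ.leadingCoeff.symm)
    rw [hdeg', degree_eq_natDegree hQ.ne_zero, hdeg]
  · rw [hroot a ha, eval_prod]
    exact Finset.prod_eq_zero ha (by simp)

theorem prod_X_sub_C_sup_span_singleton {p : ℕ} [Fact p.Prime] {L : Type*} [Field L]
    [Algebra (ZMod p) L] (H H' : Submodule (ZMod p) L) (w : L) {s s' : Finset L}
    (hs : (s : Set L) = H) (hs' : (s' : Set L) = H') (hH' : H' = H ⊔ Submodule.span (ZMod p) {w})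
    (hcard : s'.card = s.card * p)
    (hadd : ∀ a b, (∏ a ∈ s, (X - C a)).eval (a + b) =
      (∏ a ∈ s, (X - C a)).eval a + (∏ a ∈ s, (X - C a)).eval b) :
    ∏ a ∈ s', (X - C a) = (∏ a ∈ s, (X - C a)) ^ p -
      C ((∏ a ∈ s, (X - C a)).eval w ^ (p - 1)) * ∏ a ∈ s, (X - C a) := by
  set P : L[X] := ∏ a ∈ s, (X - C a) with hP
  have hp : 1 < p := (Fact.out : p.Prime).one_lt
  have hmon : P.Monic := monic_prod_X_sub_C id s
  have hdeg : P.natDegree = s.card := by simp [hP]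
  have hspos : 0 < s.card := Finset.card_pos.2 ⟨0, by
    rw [← Finset.mem_coe, hs]; exact H.zero_mem⟩
  have hlt : (C (P.eval w ^ (p - 1)) * P).degree < (P ^ p).degree := by
    refine (degree_mul_le _ _).trans_lt ((add_le_of_nonpos_left degree_C_le).trans_lt ?_)
    rw [degree_pow, degree_eq_natDegree hmon.ne_zero, hdeg, nsmul_eq_mul]
    exact_mod_cast (Nat.lt_mul_iff_one_lt_left hspos).2 hp
  refine prod_X_sub_C_eq_of_forall_eval_eq_zero ((hmon.pow p).sub_of_left hlt) ?_ fun a ha => ?_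
  · rw [natDegree_sub_eq_left_of_natDegree_lt (?_), natDegree_pow, hdeg,
      hcard, mul_comm]
    rw [natDegree_pow, hdeg]
    exact (natDegree_C_mul_le _ _).trans_lt (hdeg.symm ▸ (Nat.lt_mul_iff_one_lt_left hspos).2 hp)
  · rw [← Finset.mem_coe, hs', hH', SetLike.mem_coe, Submodule.mem_sup] at ha
    obtain ⟨h, hh, _, hw, rfl⟩ := ha
    obtain ⟨c, rfl⟩ := Submodule.mem_span_singleton.1 hw
    let f : L →+ L := AddMonoidHom.mk' (fun a => P.eval a) hadd
    have hc : P.eval (c • w) = c • P.eval w := (f.toZModLinearMap p).map_smul c w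
    have hh0 : P.eval h = 0 := by
      rw [hP, eval_prod]
      exact Finset.prod_eq_zero (i := h) (by rwa [← Finset.mem_coe, hs]) (by simp)
    simp only [eval_sub, eval_mul, eval_pow, eval_C, hadd, hc, hh0, zero_add]
    rw [_root_.smul_pow, ZMod.pow_card, mul_smul_comm, ← pow_succ, Nat.sub_add_cancel hp.le, sub_self]

theorem card_span_image_lt {p n : ℕ} [Fact p.Prime] {L : Type*} [Field L] [Finite L]
    [Algebra (ZMod p) L] {w : Fin n → L} (hw : LinearIndependent (ZMod p) w) {i : ℕ} (hi : i ≤ n) :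
    Nat.card (Submodule.span (ZMod p) (w '' {j : Fin n | (j : ℕ) < i})) = p ^ i := by
  have h : w '' {j : Fin n | (j : ℕ) < i} = Set.range (w ∘ Fin.castLE hi) := by
    rw [Set.range_comp, Fin.range_castLE]
  rw [h, Module.natCard_eq_pow_finrank (K := ZMod p),
    finrank_span_eq_card (hw.comp _ (Fin.castLE_injective hi))]
  simp

theorem prod_span_X_sub_C_succ {p n : ℕ} [Fact p.Prime] {L : Type*} [Field L] [Finite L]
    [Algebra (ZMod p) L] {w : Fin n → L} (hw : LinearIndependent (ZMod p) w)
    {P : ℕ → L[X]} (hP : ∀ i, P i = ∏ a ∈ (Set.toFinite ((Submodule.span (ZMod p)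
      (w '' {j : Fin n | (j : ℕ) < i}) : Submodule (ZMod p) L) : Set L)).toFinset, (X - C a))
    {i : ℕ} (hi : i < n) :
    P (i + 1) = P i ^ p - C ((P i).eval (w ⟨i, hi⟩) ^ (p - 1)) * P i := by
  have step : ∀ k (hk : k < n), (∀ a b, (P k).eval (a + b) = (P k).eval a + (P k).eval b) →
      P (k + 1) = P k ^ p - C ((P k).eval (w ⟨k, hk⟩) ^ (p - 1)) * P k := fun k hk hadd => by
    rw [hP k] at hadd ⊢
    rw [hP (k + 1)]
    refine prod_X_sub_C_sup_span_singleton _ _ (w ⟨k, hk⟩) (Set.Finite.coe_toFinset _)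
      (Set.Finite.coe_toFinset _) ?_ ?_ hadd
    · rw [← Submodule.span_union, Set.union_singleton, ← Set.image_insert_eq]
      congr 2
      ext j
      simp [Fin.ext_iff]
      omega
    · rw [← Nat.card_eq_card_finite_toFinset, ← Nat.card_eq_card_finite_toFinset]
      exact (card_span_image_lt hw hk).trans
        ((pow_succ p k).trans (congrArg (· * p) (card_span_image_lt hw hk.le).symm))
  have : CharP L p := charP_of_injective_algebraMap (algebraMap (ZMod p) L).injective p
  have hadd : ∀ k, k ≤ n → ∀ a b, (P k).eval (a + b) = (P k).eval a + (P k).eval b := by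
    intro k
    induction k with
    | zero =>
      intro _ a b
      have : P 0 = X := by
        rw [hP]; simp [Set.Finite.toFinset]
      simp [this]
    | succ k ih =>
      intro hk a b
      rw [step k hk (ih (by omega))]
      simp only [eval_sub, eval_pow, eval_mul, eval_C, ih (by omega : k ≤ n), add_pow_char]
      ring
  exact step i hi (hadd i hi.le)

theorem eq_pow_sub_C_mul_of_map {F L : Type*} [Field F] [Field L] [Algebra F L] {P Q : F[X]}
    (hP : P.Monic) {p : ℕ} {e : L} (h : Q.map (algebraMap F L) =
      P.map (algebraMap F L) ^ p - C e * P.map (algebraMap F L)) :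
    ∃ d : F, Q = P ^ p - C d * P := by
  refine ⟨(P ^ p - Q).coeff P.natDegree, map_injective _ (algebraMap F L).injective ?_⟩
  have he : algebraMap F L ((P ^ p - Q).coeff P.natDegree) = e := by
    rw [← coeff_map, Polynomial.map_sub, h, Polynomial.map_pow, sub_sub_cancel, coeff_C_mul,
      coeff_map, coeff_natDegree, hP.leadingCoeff, map_one, mul_one]
  rw [Polynomial.map_sub, Polynomial.map_mul, map_C, he, h, Polynomial.map_pow]

theorem relfinrank_adjoin_pair_of_hermitian {F E : Type*} [Field F] [Field E] [Algebra F E]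
    {x z : E} (hx : Transcendental F x) {q : ℕ} (hq : 1 < q) (h : z ^ q + z = x ^ (q + 1))
    (hgen : IntermediateField.adjoin F {x, z} = ⊤) {M P : F[X]} (hM : 0 < M.natDegree)
    (hP : 0 < P.natDegree) (hMP : X ^ q + X = M.comp P) :
    (IntermediateField.adjoin F {x}).relfinrank (IntermediateField.adjoin F {x, aeval z P}) =
      M.natDegree := by
  have hdeg : q = M.natDegree * P.natDegree := by
    rw [← natDegree_comp, ← hMP, natDegree_add_eq_left_of_natDegree_lt] <;> simp [hq]
  have hMt : aeval (aeval z P) M = x ^ (q + 1) := by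
    rw [← aeval_comp, ← hMP]
    simpa using h
  set t := aeval z P with ht
  set K := IntermediateField.adjoin F {x} with hK
  have hA : K ⊔ IntermediateField.adjoin F {t} = IntermediateField.adjoin F {x, t} := by
    rw [← IntermediateField.adjoin_union, Set.singleton_union]
  set A := IntermediateField.adjoin F {x, t}
  have hxK : x ∈ K := IntermediateField.mem_adjoin_simple_self F x
  have hKA : K ≤ A := hA ▸ le_sup_left
  have htA : t ∈ A := IntermediateField.subset_adjoin F _ (by simp)
  have hAtop : A ⊔ IntermediateField.adjoin F {z} = ⊤ := by
    rw [eq_top_iff, ← hgen, ← Set.singleton_union, IntermediateField.adjoin_union]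
    exact sup_le_sup_right hKA _
  have hdM : (M.map (algebraMap F K) - C ((⟨x, hxK⟩ : K) ^ (q + 1))).natDegree = M.natDegree := by
    rw [natDegree_sub_C, natDegree_map]
  have hdP : (P.map (algebraMap F A) - C (⟨t, htA⟩ : A)).natDegree = P.natDegree := by
    rw [natDegree_sub_C, natDegree_map]
  obtain ⟨h1, h2⟩ := relfinrank_sup_adjoin_simple_le K (t := t)
    (ne_zero_of_natDegree_gt (hdM.symm ▸ hM)) (by
      simp [aeval_map_algebraMap, hMt, IntermediateField.algebraMap_apply])
  obtain ⟨h3, h4⟩ := relfinrank_sup_adjoin_simple_le A (t := z)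
    (ne_zero_of_natDegree_gt (hdP.symm ▸ hP)) (by
      simp [aeval_map_algebraMap, ← ht, IntermediateField.algebraMap_apply])
  rw [hA, hdM] at h2
  rw [hAtop, hdP] at h4
  have hmul := IntermediateField.relfinrank_mul_relfinrank hKA (le_top : A ≤ ⊤)
  rw [IntermediateField.relfinrank_top_right K, finrank_of_hermitian hx hq h hgen, hdeg] at hmul
  refine le_antisymm h2 (Nat.le_of_mul_le_mul_right ?_ hP)
  rw [← hmul]
  exact Nat.mul_le_mul_left _ h4

/-- `q = p^n`. Let `G₁ = F_q(x)` and let `G₂ = F_q(x, z)` with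
`z^q + z = x^{q+1}` be the descent over `F_q` of the Hermitian function field. With
`𝒫 ⊆ F_{q²}` the root set of `T^q + T`, an `F_p`-basis `(w₁,…,w_n)` of `𝒫`, and the
associated `p`-polynomials `P_i, M_i` over `F_q` with `T^q + T = M_i ⋆ P_i`, define
for `1 ≤ i < n` the field `G_{1,i} = F_q(x, t_i)` where `t_i = P_{n-i}(z)` and
`M_{n-i}(t_i) = x^{q+1}`. Then the full constant field of each `G_{1,i}` is `F_q`,
`[G_{1,i} : F_q(x)] = p^i` and `G₁ ⊂ G_{1,1} ⊂ ⋯ ⊂ G_{1,n-1} ⊂ G₂`. -/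
theorem stmt_11
    (p n : ℕ) (hp : p.Prime) (hn : 0 < n) (q : ℕ) (hq : q = p ^ n)
    (Fq Fq2 : Type) [Field Fq] [Fintype Fq] [Field Fq2] [Fintype Fq2]
    [Algebra Fq Fq2] [Algebra (ZMod p) Fq2]
    (hcardq : Fintype.card Fq = q) (hcardq2 : Fintype.card Fq2 = q ^ 2)
    -- `(w₁,…,w_n)` is an `F_p`-basis of the root set `𝒫` of `T^q + T`
    (w : Fin n → Fq2) (hwroot : ∀ i, (w i) ^ q + w i = 0)
    (hwind : LinearIndependent (ZMod p) w)
    (hwspan : (Submodule.span (ZMod p) (Set.range w) : Set Fq2) =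
      {α : Fq2 | α ^ q + α = 0})
    -- the associated `p`-polynomials `P_i` and `M_i` over `F_q`, with `P = M_i ⋆ P_i`
    (Pi Mi : ℕ → Polynomial Fq)
    (hPi : ∀ i : ℕ, 1 ≤ i → i < n → (Pi i).map (algebraMap Fq Fq2) =
      ∏ a ∈ (Set.toFinite ((Submodule.span (ZMod p) (w '' {j : Fin n | (j : ℕ) < i}) :
        Submodule (ZMod p) Fq2) : Set Fq2)).toFinset, (X - C a))
    (hMiPi : ∀ i : ℕ, 1 ≤ i → i < n → (X ^ q + X : Polynomial Fq) = (Mi i).comp (Pi i))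
    -- `G₂ = F_q(x, z)` with `z^q + z = x^{q+1}`, the descent of the Hermitian field
    (G₂ : Type) [Field G₂] [Algebra Fq G₂] (x z : G₂)
    (hx : Transcendental Fq x)
    (hherm : z ^ q + z = x ^ (q + 1))
    (hgen : IntermediateField.adjoin Fq {x, z} = (⊤ : IntermediateField Fq G₂)) :
    let t : ℕ → G₂ := fun i => Polynomial.aeval z (Pi (n - i));
    (∀ i : ℕ, 1 ≤ i → i < n →
      -- `M_{n-i}(t_i) = x^{q+1}`
      Polynomial.aeval (t i) (Mi (n - i)) = x ^ (q + 1) ∧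
      -- the full constant field of `G_{1,i} = F_q(x, t_i)` is `F_q`
      (∀ y : G₂, y ∈ IntermediateField.adjoin Fq {x, t i} → IsAlgebraic Fq y →
        ∃ c : Fq, algebraMap Fq G₂ c = y) ∧
      -- `[G_{1,i} : F_q(x)] = p^i`
      (∃ h : IntermediateField.adjoin Fq {x} ≤ IntermediateField.adjoin Fq {x, t i},
        Module.finrank (↥(IntermediateField.adjoin Fq {x}))
          (↥(IntermediateField.extendScalars h)) = p ^ i)) ∧
    -- the chain `G₁ ⊂ G_{1,1} ⊂ ⋯ ⊂ G_{1,n-1} ⊂ G₂`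
    (1 < n → IntermediateField.adjoin Fq {x} < IntermediateField.adjoin Fq {x, t 1}) ∧
    (∀ i : ℕ, 1 ≤ i → i + 1 < n →
      IntermediateField.adjoin Fq {x, t i} < IntermediateField.adjoin Fq {x, t (i + 1)}) ∧
    (1 < n → IntermediateField.adjoin Fq {x, t (n - 1)} < ⊤) := by
  intro t
  have : Fact p.Prime := ⟨hp⟩
  have hp1 := hp.one_lt
  have hq1 : 1 < q := hq ▸ Nat.one_lt_pow hn.ne' hp1
  let P : ℕ → Fq2[X] := fun i => ∏ a ∈ (Set.toFinite ((Submodule.span (ZMod p)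
    (w '' {j : Fin n | (j : ℕ) < i}) : Submodule (ZMod p) Fq2) : Set Fq2)).toFinset, (X - C a)
  have hmonic : ∀ i, 1 ≤ i → i < n → (Pi i).Monic := fun i h1 h2 =>
    monic_of_injective (algebraMap Fq Fq2).injective (hPi i h1 h2 ▸ monic_prod_X_sub_C id _)
  have hdegP : ∀ i, 1 ≤ i → i < n → (Pi i).natDegree = p ^ i := fun i h1 h2 => by
    rw [← natDegree_map (algebraMap Fq Fq2), hPi i h1 h2, natDegree_finsetProd_X_sub_C_eq_card,
      ← Nat.card_eq_card_finite_toFinset]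
    exact card_span_image_lt hwind h2.le
  have hdegM : ∀ i, 1 ≤ i → i < n → (Mi i).natDegree = p ^ (n - i) := fun i h1 h2 => by
    have h : q = (Mi i).natDegree * (Pi i).natDegree := by
      rw [← natDegree_comp, ← hMiPi i h1 h2, natDegree_add_eq_left_of_natDegree_lt] <;> simp [hq1]
    rw [hdegP i h1 h2, hq, ← Nat.sub_add_cancel h2.le, pow_add] at h
    exact (Nat.eq_of_mul_eq_mul_right (pow_pos hp.pos i) h).symm
  have hsucc : ∀ i, 1 ≤ i → i + 1 < n → ∃ d, Pi (i + 1) = Pi i ^ p - C d * Pi i :=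
    fun i h1 h2 => by
      have h := prod_span_X_sub_C_succ hwind (P := P) (fun _ => rfl) (by omega : i < n)
      simp only [P, ← hPi i h1 (by omega), ← hPi (i + 1) (by omega) h2] at h
      exact eq_pow_sub_C_mul_of_map (hmonic i h1 (by omega)) h
  have hrel : ∀ i, 1 ≤ i → i < n → (IntermediateField.adjoin Fq {x}).relfinrank
      (IntermediateField.adjoin Fq {x, t i}) = p ^ i := fun i h1 h2 => by
    rw [relfinrank_adjoin_pair_of_hermitian hx hq1 hherm hgen _ _
      (hMiPi (n - i) (by omega) (by omega)), hdegM (n - i) (by omega) (by omega),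
      Nat.sub_sub_self h2.le]
    · rw [hdegM (n - i) (by omega) (by omega)]; exact pow_pos hp.pos _
    · rw [hdegP (n - i) (by omega) (by omega)]; exact pow_pos hp.pos _
  have hle : ∀ y : G₂, IntermediateField.adjoin Fq {x} ≤ IntermediateField.adjoin Fq {x, y} :=
    fun y => IntermediateField.adjoin.mono _ _ _ (by simp)
  refine ⟨fun i h1 h2 => ⟨?_, fun y _ hy => mem_range_algebraMap_of_hermitian hx hq1 hherm hgen hy,
    hle _, ?_⟩, fun h => ?_, fun i h1 h2 => ?_, fun h => ?_⟩
  · rw [← aeval_comp, ← hMiPi (n - i) (by omega) (by omega)]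
    simpa using hherm
  · rw [← IntermediateField.relfinrank_eq_finrank_of_le, hrel i h1 h2]
  · refine lt_of_le_of_ne (hle _) fun heq => ?_
    have := hrel 1 le_rfl h
    rw [← heq, IntermediateField.relfinrank_self, pow_one] at this
    omega
  · refine lt_of_le_of_ne ?_ fun heq => ?_
    · rw [IntermediateField.adjoin_le_iff, Set.insert_subset_iff, Set.singleton_subset_iff]
      refine ⟨IntermediateField.subset_adjoin _ _ (by simp), ?_⟩
      obtain ⟨d, hd⟩ := hsucc (n - (i + 1)) (by omega) (by omega)
      have ht : t (i + 1) ∈ IntermediateField.adjoin Fq {x, t (i + 1)} :=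
        IntermediateField.subset_adjoin _ _ (by simp)
      have hti : t i = t (i + 1) ^ p - algebraMap Fq G₂ d * t (i + 1) := by
        simp only [t]
        rw [show n - i = n - (i + 1) + 1 by omega, hd]
        simp
      rw [SetLike.mem_coe, hti]
      exact sub_mem (pow_mem ht p) (mul_mem (IntermediateField.algebraMap_mem _ d) ht)
    · have h3 := hrel i h1 (by omega)
      rw [heq, hrel (i + 1) (by omega) h2] at h3
      have := Nat.pow_right_injective hp1 h3
      omega
  · refine lt_of_le_of_ne le_top fun heq => ?_
    have h3 := hrel (n - 1) (by omega) (by omega)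
    rw [heq, IntermediateField.relfinrank_top_right, finrank_of_hermitian hx hq1 hherm hgen,
      hq] at h3
    have := Nat.pow_right_injective hp1 h3
    omega
end

section
/- Set q = p^n a prime power. Let (F_i)_{i≥1} be the Garcia–Stichtenoth tower over F_{q²}: F₁ = F_{q²}(x₁), and F_{i+1} = F_i(z_{i+1}) where z_{i+1}^q + z_{i+1} = x_i^{q+1} and x_i = z_i / x_{i−1} for i ≥ 2. Then the descent of the definition field of the completed tower from F_{q²} to F_q is possible: there exists a tower (G_{i,s})_{i≥1, 0≤s<n} of function fields over F_q, each with full constant field F_q, given explicitly by G_{1,0} = F_q(x₁), G_{i+1,0} = G_{i,0}(z_{i+1}) with z_{i+1}^q + z_{i+1} = x_i^{q+1}, and G_{i,s} = G_{i,0}(t_{i,s}) with t_{i,s} = P_{n−s}(z_{i+1}) and M_{n−s}(t_{i,s}) = x_i^{q+1}, such that G_{i,0} ⊂ G_{i,1} ⊂ ⋯ ⊂ G_{i,n−1} ⊂ G_{i+1,0}, [G_{i,s} : G_{i,0}] = p^s, and the constant field extension F_{i,s} := G_{i,s} ⊗_{F_q} F_{q²} gives the completed Garcia–Stichtenoth tower,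 with F_{i,0} = F_i. -/
open Polynomial

section Valuations

variable {F Ω Γ₀ : Type*} [Field F] [Field Ω] [Algebra F Ω]
  [LinearOrderedCommGroupWithZero Γ₀]

/-- A sum of finitely many elements with pairwise distinct nonzero valuations is dominated by
exactly one of its terms. -/
theorem Valuation.exists_dominant_term (v : Valuation Ω Γ₀) {s : Finset ℕ} (hs : s.Nonempty)
    (a : ℕ → Ω) (ha : ∀ j ∈ s, a j ≠ 0)
    (hinj : ∀ j ∈ s, ∀ k ∈ s, v (a j) = v (a k) → j = k) :
    ∃ j ∈ s, v (∑ k ∈ s, a k) = v (a j) ∧ v (∑ k ∈ s, a k - a j) < v (a j) := by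
  obtain ⟨j, hj, hmax⟩ := s.exists_max_image (fun k => v (a k)) hs
  have hlt : v (∑ k ∈ s.erase j, a k) < v (a j) := by
    refine v.map_sum_lt ((v.ne_zero_iff).2 (ha j hj)) fun k hk => ?_
    obtain ⟨hkj, hk⟩ := Finset.mem_erase.1 hk
    exact lt_of_le_of_ne (hmax k hk) fun h => hkj (hinj k hk j hj h)
  rw [← Finset.add_sum_erase s a hj]
  exact ⟨j, hj, v.map_add_eq_of_lt_left hlt, by rwa [add_sub_cancel_left]⟩

/-- If all nonzero constants have valuation one and `1 < v t`, the leading term of a polynomial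
in `t` dominates. -/
theorem Valuation.aeval_eq_pow_natDegree (v : Valuation Ω Γ₀)
    (hv : ∀ c : F, c ≠ 0 → v (algebraMap F Ω c) = 1) {t : Ω} (ht : 1 < v t)
    (f : F[X]) (hf : f ≠ 0) :
    v (aeval t f) = v t ^ f.natDegree := by
  have ht0 : t ≠ 0 := by
    rintro rfl
    simp at ht
  have hval : ∀ j ∈ f.support, v (algebraMap F Ω (f.coeff j) * t ^ j) = v t ^ j := by
    intro j hj
    rw [map_mul, hv _ (mem_support_iff.1 hj), one_mul, map_pow]
  have hlead : f.natDegree ∈ f.support := natDegree_mem_support_of_nonzero hf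
  have hsum : v (∑ k ∈ f.support.erase f.natDegree, algebraMap F Ω (f.coeff k) * t ^ k) <
      v (algebraMap F Ω (f.coeff f.natDegree) * t ^ f.natDegree) := by
    rw [hval _ hlead]
    refine v.map_sum_lt (pow_ne_zero _ ((v.ne_zero_iff).2 ht0)) fun k hk => ?_
    obtain ⟨hkj, hk⟩ := Finset.mem_erase.1 hk
    rw [hval _ hk]
    exact pow_lt_pow_right₀ ht (lt_of_le_of_ne (le_natDegree_of_mem_supp _ hk) hkj)
  rw [aeval_eq_sum_range, ← hval _ hlead, ← v.map_add_eq_of_lt_left hsum,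
    Finset.add_sum_erase _ (fun k => algebraMap F Ω (f.coeff k) * t ^ k) hlead]
  congr 1
  simp_rw [Algebra.smul_def]
  refine (Finset.sum_subset supp_subset_range_natDegree_succ fun k _ hk => ?_).symm
  rw [notMem_support_iff.1 hk, map_zero, zero_mul]

/-- An algebraic element has valuation at most one. -/
theorem Valuation.le_one_of_isAlgebraic (v : Valuation Ω Γ₀)
    (hv : ∀ c : F, c ≠ 0 → v (algebraMap F Ω c) = 1) {y : Ω} (hy : IsAlgebraic F y) :
    v y ≤ 1 := by
  by_contra! h
  obtain ⟨f, hf, hfy⟩ := hy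
  have hval := v.aeval_eq_pow_natDegree hv h f hf
  rw [hfy, map_zero] at hval
  exact pow_ne_zero _ (zero_lt_one.trans h).ne' hval.symm

/-- An algebraic element of valuation less than one vanishes. -/
theorem Valuation.eq_zero_of_isAlgebraic_of_lt_one (v : Valuation Ω Γ₀)
    (hv : ∀ c : F, c ≠ 0 → v (algebraMap F Ω c) = 1) {y : Ω} (hy : IsAlgebraic F y)
    (h : v y < 1) : y = 0 := by
  by_contra h0
  have hinv := v.le_one_of_isAlgebraic hv hy.inv
  rw [map_inv₀] at hinv
  exact absurd hinv (not_le.2 ((one_lt_inv₀ (zero_lt_iff.2 ((v.ne_zero_iff).2 h0))).2 h))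

/-- The valuation `v` has value group contained in the powers of `δ` on `L`, and the residue
field of `L` is `F`. -/
structure Valuation.IsRational (v : Valuation Ω Γ₀) (L : IntermediateField F Ω) (δ : Γ₀) :
    Prop where
  exists_zpow : ∀ f ∈ L, f ≠ 0 → ∃ k : ℤ, v f = δ ^ k
  exists_residue : ∀ f ∈ L, v f ≤ 1 → ∃ c : F, v (f - algebraMap F Ω c) < 1

theorem Valuation.IsRational.exists_algebraMap_eq {v : Valuation Ω Γ₀}
    {L : IntermediateField F Ω} {δ : Γ₀} (h : v.IsRational L δ)
    (hv : ∀ c : F, c ≠ 0 → v (algebraMap F Ω c) = 1) {y : Ω} (hyL : y ∈ L)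
    (hy : IsAlgebraic F y) : ∃ c : F, algebraMap F Ω c = y := by
  obtain ⟨c, hc⟩ := h.exists_residue y hyL (v.le_one_of_isAlgebraic hv hy)
  refine ⟨c, (sub_eq_zero.1 ?_).symm⟩
  exact v.eq_zero_of_isAlgebraic_of_lt_one hv (hy.sub (isAlgebraic_algebraMap c)) hc

/-- The place at infinity of a rational function field. -/
theorem Valuation.isRational_adjoin_simple (v : Valuation Ω Γ₀)
    (hv : ∀ c : F, c ≠ 0 → v (algebraMap F Ω c) = 1) {t : Ω} (ht : 1 < v t) :
    v.IsRational (IntermediateField.adjoin F {t}) (v t) := by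
  have hvt0 : v t ≠ 0 := (zero_lt_one.trans ht).ne'
  have hne : ∀ s : F[X], aeval t s ≠ 0 → s ≠ 0 := by
    rintro s hs rfl
    exact hs (map_zero _)
  have hzpow : ∀ f ∈ IntermediateField.adjoin F {t}, f ≠ 0 → ∃ k : ℤ, v f = v t ^ k := by
    intro f hf hf0
    obtain ⟨r, s, rfl⟩ := (IntermediateField.mem_adjoin_simple_iff F f).1 hf
    obtain ⟨hr, hs⟩ := div_ne_zero_iff.1 hf0
    refine ⟨r.natDegree - s.natDegree, ?_⟩
    rw [map_div₀, v.aeval_eq_pow_natDegree hv ht r (hne r hr), v.aeval_eq_pow_natDegree hv ht s (hne s hs),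
      zpow_sub₀ hvt0, zpow_natCast, zpow_natCast]
  refine ⟨hzpow, fun f hf hf1 => ?_⟩
  rcases hf1.lt_or_eq with hlt | heq
  · exact ⟨0, by simpa using hlt⟩
  have hf0 : f ≠ 0 := by
    rintro rfl
    simp at heq
  obtain ⟨r, s, rfl⟩ := (IntermediateField.mem_adjoin_simple_iff F f).1 hf
  obtain ⟨hr, hs⟩ := div_ne_zero_iff.1 hf0
  have hr0 := hne r hr
  have hs0 := hne s hs
  have hdeg : r.natDegree = s.natDegree := by
    rw [map_div₀, v.aeval_eq_pow_natDegree hv ht r hr0, v.aeval_eq_pow_natDegree hv ht s hs0,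
      div_eq_one_iff_eq (pow_ne_zero _ hvt0)] at heq
    exact pow_right_injective₀ (zero_lt_one.trans ht) ht.ne' heq
  have hls : s.leadingCoeff ≠ 0 := leadingCoeff_ne_zero.2 hs0
  set c : F := r.leadingCoeff / s.leadingCoeff with hc
  have hc0 : c ≠ 0 := div_ne_zero (leadingCoeff_ne_zero.2 hr0) hls
  refine ⟨c, ?_⟩
  have hdiff : aeval t r / aeval t s - algebraMap F Ω c = aeval t (r - C c * s) / aeval t s := by
    rw [_root_.map_sub, map_mul, aeval_C, sub_div, mul_div_assoc, div_self hs, mul_one]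
  rw [hdiff, map_div₀]
  by_cases h0 : r - C c * s = 0
  · simp [h0]
  rw [div_lt_one₀ (zero_lt_iff.2 ((v.ne_zero_iff).2 hs)), v.aeval_eq_pow_natDegree hv ht s hs0,
    v.aeval_eq_pow_natDegree hv ht _ h0]
  refine pow_lt_pow_right₀ ht ?_
  rw [← hdeg]
  refine natDegree_lt_natDegree h0 (degree_sub_lt_left ?_ hr0 ?_)
  · rw [degree_C_mul hc0, degree_eq_natDegree hr0, degree_eq_natDegree hs0, hdeg]
  · rw [leadingCoeff_mul, leadingCoeff_C, hc, div_mul_cancel₀ _ hls]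

/-- A totally ramified extension of degree `m`, generated by an element whose valuation
is prime to `m`. -/
theorem Valuation.IsRational.adjoin_root {v : Valuation Ω Γ₀} {L : IntermediateField F Ω}
    {γ : Γ₀} {m e : ℕ} (hγ : 1 < γ) (h : v.IsRational L (γ ^ m)) (hme : m.Coprime e)
    {t : Ω} (ht : v t = γ ^ e) {f : L[X]} (hf0 : f ≠ 0) (hfm : f.natDegree = m)
    (hft : aeval t f = 0) :
    v.IsRational ((IntermediateField.adjoin L {t}).restrictScalars F) γ ∧
      Module.finrank L (IntermediateField.adjoin L {t}) = m := by
  have hγ0 : γ ≠ 0 := (zero_lt_one.trans hγ).ne'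
  have ht0 : t ≠ 0 := by
    rintro rfl
    rw [map_zero] at ht
    exact pow_ne_zero _ hγ0 ht.symm
  have hterm : ∀ (a : L) (j : ℕ), a ≠ 0 → ∃ k : ℤ, v (a * t ^ j) = γ ^ (m * k + e * j : ℤ) := by
    intro a j ha
    obtain ⟨k, hk⟩ := h.exists_zpow a a.2 (by simpa using ha)
    refine ⟨k, ?_⟩
    rw [map_mul, map_pow, hk, ht, zpow_add₀ hγ0, zpow_mul, zpow_mul, zpow_natCast, zpow_natCast,
      zpow_natCast]
  have hinj : Function.Injective fun k : ℤ => γ ^ k := (zpow_right_strictMono₀ hγ).injective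
  have hdvd : ∀ j k : ℕ, j < m → k < m → (m : ℤ) ∣ e * (j - k) → j = k := by
    intro j k hj hk hd
    have h1 : (m : ℤ) ∣ j - k :=
      (Nat.isCoprime_iff_coprime.2 hme).dvd_of_dvd_mul_left hd
    have h2 := Int.eq_zero_of_abs_lt_dvd h1 (by rw [abs_lt]; omega)
    omega
  have hdom : ∀ g : L[X], g ≠ 0 → g.natDegree < m → ∃ j < m, g.coeff j ≠ 0 ∧
      v (aeval t g) = v (g.coeff j * t ^ j) ∧
      v (aeval t g - g.coeff j * t ^ j) < v (g.coeff j * t ^ j) := by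
    intro g hg hgm
    have hlt : ∀ j ∈ g.support, j < m := fun j hj =>
      (le_natDegree_of_mem_supp j hj).trans_lt hgm
    have heq : aeval t g = ∑ j ∈ g.support, (g.coeff j : Ω) * t ^ j := by
      rw [aeval_eq_sum_range]
      refine (Finset.sum_subset supp_subset_range_natDegree_succ fun k _ hk => ?_).symm
      rw [notMem_support_iff.1 hk, zero_smul]
    obtain ⟨j, hj, h1, h2⟩ := v.exists_dominant_term (nonempty_support_iff.2 hg)
      (fun j => (g.coeff j : Ω) * t ^ j)
      (fun j hj => mul_ne_zero (by simpa using hj) (pow_ne_zero _ ht0))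
      (fun j hj k hk hjk => by
        obtain ⟨a, ha⟩ := hterm _ j (mem_support_iff.1 hj)
        obtain ⟨b, hb⟩ := hterm _ k (mem_support_iff.1 hk)
        rw [ha, hb] at hjk
        have := hinj hjk
        exact hdvd j k (hlt j hj) (hlt k hk) ⟨b - a, by linear_combination this⟩)
    exact ⟨j, hlt j hj, mem_support_iff.1 hj, by rw [heq, h1], by rw [heq]; exact h2⟩
  have halg : IsAlgebraic L t := ⟨f, hf0, hft⟩
  have hint : IsIntegral L t := halg.isIntegral
  have hle : (minpoly L t).natDegree ≤ m :=
    hfm ▸ natDegree_le_of_dvd (minpoly.dvd L t hft) hf0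
  have hmin : (minpoly L t).natDegree = m := by
    refine le_antisymm hle (not_lt.1 fun hlt => ?_)
    obtain ⟨j, -, hj, h1, -⟩ := hdom _ (minpoly.ne_zero hint) hlt
    rw [minpoly.aeval, map_zero, eq_comm, v.zero_iff] at h1
    exact mul_ne_zero (by simpa using hj) (pow_ne_zero _ ht0) h1
  have hrep : ∀ y ∈ IntermediateField.adjoin L {t}, ∃ g : L[X], y = aeval t g ∧
      (g ≠ 0 → g.natDegree < m) := by
    intro y hy
    rw [← IntermediateField.mem_toSubalgebra,
      IntermediateField.adjoin_simple_toSubalgebra_of_isAlgebraic halg,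
      Algebra.adjoin_singleton_eq_range_aeval] at hy
    obtain ⟨g, rfl⟩ := hy
    refine ⟨g %ₘ minpoly L t, (aeval_modByMonic_eq_self_of_root (minpoly.aeval L t)).symm,
      fun h0 => ?_⟩
    rw [← hmin]
    exact natDegree_lt_natDegree h0 (degree_modByMonic_lt g (minpoly.monic hint))
  refine ⟨⟨fun y hy hy0 => ?_, fun y hy hy1 => ?_⟩, ?_⟩
  · obtain ⟨g, rfl, hg⟩ := hrep y hy
    have hg0 : g ≠ 0 := by
      rintro rfl
      exact hy0 (map_zero _)
    obtain ⟨j, -, hj, h1, -⟩ := hdom g hg0 (hg hg0)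
    obtain ⟨k, hk⟩ := hterm _ j hj
    exact ⟨_, h1.trans hk⟩
  · rcases hy1.lt_or_eq with hlt | heq
    · exact ⟨0, by simpa using hlt⟩
    obtain ⟨g, rfl, hg⟩ := hrep y hy
    have hg0 : g ≠ 0 := by
      rintro rfl
      simp at heq
    obtain ⟨j, hjm, hj, h1, h2⟩ := hdom g hg0 (hg hg0)
    obtain ⟨k, hk⟩ := hterm _ j hj
    have hj0 : j = 0 := by
      have h3 : (m * k + e * j : ℤ) = 0 := hinj (by
        change γ ^ (m * k + e * j : ℤ) = γ ^ (0 : ℤ)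
        rw [← hk, ← h1, heq, zpow_zero])
      exact hdvd j 0 hjm (by omega) ⟨-k, by push_cast; linear_combination h3⟩
    subst hj0
    rw [pow_zero, mul_one] at h1 h2
    rw [heq] at h1
    obtain ⟨c, hc⟩ := h.exists_residue _ (g.coeff 0).2 h1.symm.le
    refine ⟨c, ?_⟩
    rw [← sub_add_sub_cancel _ (g.coeff 0 : Ω)]
    exact v.map_add_lt (h2.trans_le h1.symm.le) hc
  · rw [IntermediateField.adjoin.finrank hint, hmin]

/-- A transcendental element has a pole at some place trivial on the constants. -/
theorem exists_valuation_one_lt_of_transcendental {t : Ω} (ht : Transcendental F t) :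
    ∃ A : ValuationSubring Ω, 1 < A.valuation t ∧
      ∀ c : F, c ≠ 0 → A.valuation (algebraMap F Ω c) = 1 := by
  have ht0 : t ≠ 0 := by
    rintro rfl
    exact ht isAlgebraic_zero
  let R : Subalgebra F Ω := Algebra.adjoin F {t⁻¹}
  let u : R := ⟨t⁻¹, Algebra.self_mem_adjoin_singleton F _⟩
  let I : Ideal R.toSubring := Ideal.span {(u : R.toSubring)}
  have hI : I ≠ ⊤ := by
    intro htop
    obtain ⟨g, hg⟩ := Ideal.mem_span_singleton'.1 ((Ideal.eq_top_iff_one I).1 htop)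
    have hgR : (g : Ω) ∈ R := g.2
    obtain ⟨P, hP⟩ := (Algebra.adjoin_singleton_eq_range_aeval F t⁻¹).le hgR
    change aeval t⁻¹ P = g at hP
    have h1 : (g : Ω) * t⁻¹ = 1 := congrArg Subtype.val hg
    have hroot : aeval t⁻¹ (P * X - 1) = 0 := by
      rw [map_sub, map_mul, aeval_X, map_one, hP, h1, sub_self]
    have halg : IsAlgebraic F t⁻¹ := by
      refine ⟨P * X - 1, fun h => ?_, hroot⟩
      have := congrArg (eval 0) h
      simp at this
    exact ht (by simpa using halg.inv)
  obtain ⟨A, hRA, hIA⟩ := Ideal.image_subset_nonunits_valuationSubring I hI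
  refine ⟨A, ?_, ?_⟩
  · have hmem : t⁻¹ ∈ A.nonunits :=
      hIA ⟨u, Ideal.subset_span rfl, rfl⟩
    rw [ValuationSubring.mem_nonunits_iff, map_inv₀] at hmem
    exact (inv_lt_one₀ (zero_lt_iff.2 ((A.valuation.ne_zero_iff).2 ht0))).1 hmem
  · have hle : ∀ c : F, A.valuation (algebraMap F Ω c) ≤ 1 := fun c =>
      (A.valuation_le_one_iff _).2 (hRA (R.algebraMap_mem c))
    intro c hc
    refine le_antisymm (hle c) ?_
    have h1 := hle c⁻¹
    rw [map_inv₀, map_inv₀] at h1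
    refine (inv_le_one₀ (zero_lt_iff.2 ((A.valuation.ne_zero_iff).2 ?_))).1 h1
    simpa using hc

end Valuations

section ConstantExtension

open scoped TensorProduct

variable {F E Ω Γ₀ : Type*} [Field F] [Field E] [Field Ω] [Algebra F E] [Algebra F Ω]
  [Algebra E Ω] [IsScalarTower F E Ω] [LinearOrderedCommGroupWithZero Γ₀]

/-- Constants that are linearly independent over the residue field stay linearly independent
over `L`. -/
theorem Valuation.IsRational.eq_zero_of_sum_eq_zero {v : Valuation Ω Γ₀}
    (hv : ∀ c : E, c ≠ 0 → v (algebraMap E Ω c) = 1) {L : IntermediateField F Ω} {δ : Γ₀}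
    (h : v.IsRational L δ) {ι : Type*} [Fintype ι] {b : ι → E} (hb : LinearIndependent F b)
    (g : ι → L) (hg : ∑ i, (g i : Ω) * algebraMap E Ω (b i) = 0) (i : ι) : g i = 0 := by
  obtain ⟨j, -, hj⟩ := Finset.exists_max_image Finset.univ (fun k => v (g k : Ω))
    ⟨i, Finset.mem_univ i⟩
  by_cases hj0 : g j = 0
  · have hi := hj i (Finset.mem_univ i)
    rw [hj0, ZeroMemClass.coe_zero, map_zero, le_zero_iff, v.zero_iff] at hi
    exact_mod_cast hi
  exfalso
  have hle : ∀ c : E, v (algebraMap E Ω c) ≤ 1 := by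
    intro c
    rcases eq_or_ne c 0 with rfl | hc
    · simp
    · exact (hv c hc).le
  have hj0' : (g j : Ω) ≠ 0 := by simpa using hj0
  have hvj : v (g j : Ω) ≠ 0 := (v.ne_zero_iff).2 hj0'
  have hres : ∀ k, ∃ c : F, v ((g k : Ω) / g j - algebraMap F Ω c) < 1 := by
    intro k
    refine h.exists_residue _ (L.div_mem (g k).2 (g j).2) ?_
    rw [map_div₀]
    exact div_le_one_of_le₀ (hj k (Finset.mem_univ k)) zero_le
  choose c hc using hres
  have hsum : v (algebraMap E Ω (∑ k, c k • b k)) < 1 := by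
    have heq : algebraMap E Ω (∑ k, c k • b k) =
        -∑ k, ((g k : Ω) / g j - algebraMap F Ω (c k)) * algebraMap E Ω (b k) := by
      have h0 : ∑ k, (g k : Ω) / g j * algebraMap E Ω (b k) = 0 := by
        simp_rw [div_mul_eq_mul_div]
        rw [← Finset.sum_div, hg, zero_div]
      simp_rw [sub_mul]
      rw [Finset.sum_sub_distrib, h0, zero_sub, neg_neg, map_sum]
      refine Finset.sum_congr rfl fun k _ => ?_
      rw [Algebra.smul_def, map_mul, ← IsScalarTower.algebraMap_apply]
    rw [heq, v.map_neg]
    refine v.map_sum_lt one_ne_zero fun k _ => ?_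
    rw [map_mul]
    exact mul_lt_one_of_lt_of_le (hc k) (hle _)
  have hzero : ∑ k, c k • b k = 0 := by
    by_contra hne
    exact hsum.ne (hv _ hne)
  have hcj : c j = 0 := Fintype.linearIndependent_iff.1 hb c hzero j
  have := hc j
  rw [hcj, map_zero, sub_zero, div_self hj0', map_one] at this
  exact this.false

theorem Valuation.IsRational.nonempty_algEquiv_tensorProduct [FiniteDimensional F E]
    {v : Valuation Ω Γ₀} (hv : ∀ c : E, c ≠ 0 → v (algebraMap E Ω c) = 1) {S : Set Ω} {δ : Γ₀}
    (h : v.IsRational (IntermediateField.adjoin F S) δ) :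
    Nonempty (IntermediateField.adjoin E S ≃ₐ[F]
      TensorProduct F (IntermediateField.adjoin F S) E) := by
  let G := IntermediateField.adjoin F S
  let φ : TensorProduct F G E →ₐ[G] Ω :=
    Algebra.TensorProduct.productLeftAlgHom (Algebra.ofId G Ω) (IsScalarTower.toAlgHom F E Ω)
  have hφ : ∀ (g : G) (c : E), φ (g ⊗ₜ[F] c) = g * algebraMap E Ω c := fun g c => rfl
  have hinj : Function.Injective φ := by
    rw [injective_iff_map_eq_zero]
    intro u hu
    let b := Module.finBasis F E
    let B := Algebra.TensorProduct.basis G b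
    have hrepr : ∑ i, (B.repr u i : Ω) * algebraMap E Ω (b i) = 0 := by
      rw [← B.sum_repr u, map_sum] at hu
      rw [← hu]
      refine Finset.sum_congr rfl fun i _ => ?_
      rw [map_smul, Algebra.TensorProduct.basis_apply, hφ, OneMemClass.coe_one, one_mul,
        Algebra.smul_def]
      rfl
    have h0 := h.eq_zero_of_sum_eq_zero hv b.linearIndependent (fun i => B.repr u i) hrepr
    rw [← B.sum_repr u]
    exact Finset.sum_eq_zero fun i _ => by rw [h0 i, zero_smul]
  have hrange : ∀ y : Ω, y ∈ φ.range ↔ y ∈ IntermediateField.adjoin E S := by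
    intro y
    constructor
    · rintro ⟨u, rfl⟩
      change φ u ∈ _
      have hG : ∀ g : G, (g : Ω) ∈ IntermediateField.adjoin E S := by
        have hle : G ≤ (IntermediateField.adjoin E S).restrictScalars F :=
          IntermediateField.adjoin_le_iff.2 (IntermediateField.subset_adjoin E S)
        exact fun g => hle g.2
      induction u with
      | zero => rw [map_zero]; exact zero_mem _
      | add a b ha hb => rw [map_add]; exact add_mem ha hb
      | tmul g c => rw [hφ]; exact mul_mem (hG g) (IntermediateField.algebraMap_mem _ c)
    · let K : IntermediateField E Ω :=
        { carrier := φ.range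
          mul_mem' := φ.range.mul_mem
          add_mem' := φ.range.add_mem
          algebraMap_mem' := fun c => ⟨1 ⊗ₜ[F] c, by
            change φ _ = _
            rw [hφ, OneMemClass.coe_one, one_mul]⟩
          inv_mem' := fun a ha => by
            obtain ⟨u, hu⟩ := ha
            have halg : IsAlgebraic G a := by
              rw [← hu]
              exact ((Algebra.IsIntegral.isIntegral u).map φ).isAlgebraic
            exact φ.range.inv_mem_of_algebraic (x := ⟨a, ⟨u, hu⟩⟩) halg }
      have hK : IntermediateField.adjoin E S ≤ K := by
        refine IntermediateField.adjoin_le_iff.2 fun s hs => ?_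
        refine ⟨(⟨s, IntermediateField.subset_adjoin F S hs⟩ : G) ⊗ₜ[F] 1, ?_⟩
        change φ _ = _
        rw [hφ, map_one, mul_one]
      exact fun hy => hK hy
  let ψ : TensorProduct F G E →ₐ[F] IntermediateField.adjoin E S :=
    AlgHom.codRestrict (φ.restrictScalars F)
      ((IntermediateField.adjoin E S).toSubalgebra.restrictScalars F)
      fun u => (hrange _).1 ⟨u, rfl⟩
  refine ⟨(AlgEquiv.ofBijective ψ ⟨fun a b hab => hinj (congrArg Subtype.val hab), ?_⟩).symm⟩
  rintro ⟨y, hy⟩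
  obtain ⟨u, hu⟩ := (hrange y).2 hy
  exact ⟨u, Subtype.ext hu⟩

end ConstantExtension

section SpanPolynomial

variable {K : Type*} [Field K] {p : ℕ} [Fact p.Prime]

theorem prod_X_sub_C_eq_pow_sub_mul [CharP K p] {S S' : Finset K} (hS : S.Nonempty) (w : K)
    (hadd : ∀ a b, eval (a + b) (∏ c ∈ S, (X - C c)) =
      eval a (∏ c ∈ S, (X - C c)) + eval b (∏ c ∈ S, (X - C c)))
    (hS' : ∀ b ∈ S', ∃ a ∈ S, ∃ k : ℕ, b = a + k • w) (hcard : S'.card = p * S.card) :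
    ∏ c ∈ S', (X - C c) = (∏ c ∈ S, (X - C c)) ^ p -
      C (eval w (∏ c ∈ S, (X - C c)) ^ (p - 1)) * ∏ c ∈ S, (X - C c) := by
  have hp : p.Prime := Fact.out
  set Q : K[X] := ∏ c ∈ S, (X - C c) with hQ
  set Q' : K[X] := ∏ c ∈ S', (X - C c) with hQ'
  have hQm : Q.Monic := monic_prod_of_monic _ _ fun c _ => monic_X_sub_C c
  have hQm' : Q'.Monic := monic_prod_of_monic _ _ fun c _ => monic_X_sub_C c
  have hdQ : Q.natDegree = S.card := natDegree_finsetProd_X_sub_C_eq_card S fun c => c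
  have hdQ' : Q'.natDegree = S'.card := natDegree_finsetProd_X_sub_C_eq_card S' fun c => c
  have hdQp : (Q ^ p).degree = S'.card := by
    rw [degree_eq_natDegree (hQm.pow p).ne_zero, hQm.natDegree_pow, hdQ, hcard]
  refine eq_of_degree_sub_lt_of_eval_finset_eq S' ?_ fun b hb => ?_
  · rw [sub_sub_eq_add_sub, add_sub_right_comm]
    refine (degree_add_le _ _).trans_lt (max_lt ?_ ?_)
    · have hdeg : Q'.degree = (Q ^ p).degree := by
        rw [hdQp, degree_eq_natDegree hQm'.ne_zero, hdQ']
      refine (degree_sub_lt_left hdeg hQm'.ne_zero ?_).trans_eq (hdeg.trans hdQp)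
      rw [hQm'.leadingCoeff, (hQm.pow p).leadingCoeff]
    · rw [C_mul']
      refine (degree_smul_le _ _).trans_lt ?_
      rw [degree_eq_natDegree hQm.ne_zero, hdQ, hcard]
      exact_mod_cast lt_mul_left hS.card_pos hp.one_lt
  · have hb0 : eval b Q' = 0 := by
      rw [hQ', eval_prod]
      exact Finset.prod_eq_zero hb (by simp)
    obtain ⟨a, ha, k, rfl⟩ := hS' b hb
    have ha0 : eval a Q = 0 := by
      rw [hQ, eval_prod]
      exact Finset.prod_eq_zero ha (by simp)
    have hk : eval (k • w) Q = k * eval w Q := by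
      rw [← nsmul_eq_mul]
      exact map_nsmul (AddMonoidHom.mk' (fun y => eval y Q) hadd) k w
    rw [hb0, eval_sub, eval_mul, eval_C, eval_pow, hadd, ha0, zero_add, hk, mul_pow,
      ← frobenius_def, map_natCast, mul_left_comm, pow_sub_one_mul hp.ne_zero, sub_self]

theorem exists_algebraMap_eq_of_pow_card_eq {F : Type*} [Field F] [Fintype F] [Algebra F K]
    {c : K} (hc : c ^ Fintype.card F = c) : ∃ a : F, algebraMap F K a = c := by
  have hne : (X ^ Fintype.card F - X : F[X]) ≠ 0 :=
    FiniteField.X_pow_card_sub_X_ne_zero F Fintype.one_lt_card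
  have hsplit : Splits (X ^ Fintype.card F - X : F[X]) := by
    rw [splits_iff_card_roots, FiniteField.roots_X_pow_card_sub_X, ← Finset.card_def,
      Finset.card_univ, FiniteField.X_pow_card_sub_X_natDegree_eq _ Fintype.one_lt_card]
  have hmem : c ∈ ((X ^ Fintype.card F - X : F[X]).map (algebraMap F K)).roots := by
    rw [mem_roots (Polynomial.map_ne_zero hne)]
    simp [hc]
  rw [hsplit.roots_map, Multiset.mem_map] at hmem
  obtain ⟨a, -, ha⟩ := hmem
  exact ⟨a, ha⟩

variable [Finite K] [Algebra (ZMod p) K] {n : ℕ}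

/-- The monic polynomial whose roots are the elements of the span of the first `j` vectors. -/
noncomputable def spanPolynomial (w : Fin n → K) (j : ℕ) : K[X] :=
  ∏ a ∈ (Set.toFinite ((Submodule.span (ZMod p) (w '' {l : Fin n | (l : ℕ) < j}) :
    Submodule (ZMod p) K) : Set K)).toFinset, (X - C a)

theorem card_toFinset_span {w : Fin n → K} (hw : LinearIndependent (ZMod p) w) {j : ℕ}
    (hj : j ≤ n) :
    (Set.toFinite ((Submodule.span (ZMod p) (w '' {l : Fin n | (l : ℕ) < j}) :
      Submodule (ZMod p) K) : Set K)).toFinset.card = p ^ j := by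
  rw [← Set.ncard_eq_toFinset_card, ← Nat.card_coe_set_eq]
  change Nat.card (Submodule.span (ZMod p) (w '' {l : Fin n | (l : ℕ) < j})) = _
  rw [Module.natCard_eq_pow_finrank (K := ZMod p), Nat.card_zmod, Set.image_eq_range]
  congr 1
  refine (finrank_span_eq_card (hw.comp _ Subtype.val_injective)).trans ?_
  rw [Fintype.card_subtype]
  change (Finset.univ.filter fun l : Fin n => (l : ℕ) < j).card = j
  rw [Fin.card_filter_val_lt, min_eq_right hj]

theorem spanPolynomial_monic (w : Fin n → K) (j : ℕ) : (spanPolynomial (p := p) w j).Monic :=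
  monic_prod_of_monic _ _ fun c _ => monic_X_sub_C c

theorem spanPolynomial_natDegree {w : Fin n → K} (hw : LinearIndependent (ZMod p) w) {j : ℕ}
    (hj : j ≤ n) : (spanPolynomial (p := p) w j).natDegree = p ^ j := by
  rw [spanPolynomial, natDegree_finsetProd_X_sub_C_eq_card, card_toFinset_span hw hj]

theorem spanPolynomial_succ_of_additive {w : Fin n → K} (hw : LinearIndependent (ZMod p) w)
    {j : ℕ} (hj : j < n)
    (hadd : ∀ a b, eval (a + b) (spanPolynomial (p := p) w j) =
      eval a (spanPolynomial (p := p) w j) + eval b (spanPolynomial (p := p) w j)) :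
    spanPolynomial (p := p) w (j + 1) = spanPolynomial (p := p) w j ^ p -
      C (eval (w ⟨j, hj⟩) (spanPolynomial (p := p) w j) ^ (p - 1)) *
        spanPolynomial (p := p) w j := by
  have : CharP K p := charP_of_injective_algebraMap (algebraMap (ZMod p) K).injective p
  refine prod_X_sub_C_eq_pow_sub_mul ⟨0, by simp⟩ _ hadd (fun b hb => ?_) ?_
  · have hset : {l : Fin n | (l : ℕ) < j + 1} = insert ⟨j, hj⟩ {l : Fin n | (l : ℕ) < j} := by
      ext l
      simp [Fin.ext_iff, le_iff_eq_or_lt]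
    rw [Set.Finite.mem_toFinset, SetLike.mem_coe, hset, Set.image_insert_eq,
      Submodule.mem_span_insert] at hb
    obtain ⟨k, a, ha, rfl⟩ := hb
    refine ⟨a, by simpa using ha, k.val, ?_⟩
    rw [add_comm, nsmul_eq_mul, Algebra.smul_def]
    congr 2
    rw [← map_natCast (algebraMap (ZMod p) K), ZMod.natCast_zmod_val]
  · rw [card_toFinset_span hw hj, card_toFinset_span hw hj.le, pow_succ']

theorem spanPolynomial_eval_add {w : Fin n → K} (hw : LinearIndependent (ZMod p) w) {j : ℕ}
    (hj : j ≤ n) (a b : K) :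
    eval (a + b) (spanPolynomial (p := p) w j) =
      eval a (spanPolynomial (p := p) w j) + eval b (spanPolynomial (p := p) w j) := by
  have : CharP K p := charP_of_injective_algebraMap (algebraMap (ZMod p) K).injective p
  induction j generalizing a b with
  | zero =>
    have h0 : spanPolynomial (p := p) w 0 = X := by
      have hcard := card_toFinset_span hw (Nat.zero_le n)
      obtain ⟨c, hc⟩ := Finset.card_eq_one.1 (hcard.trans (pow_zero p))
      have hc0 : (0 : K) = c := by
        rw [← Finset.mem_singleton, ← hc]
        simp
      rw [spanPolynomial, hc, Finset.prod_singleton, ← hc0, C_0, sub_zero]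
    simp [h0]
  | succ j ih =>
    rw [spanPolynomial_succ_of_additive hw hj (ih (by omega))]
    simp only [eval_sub, eval_mul, eval_pow, eval_C, ih (by omega) a b, add_pow_char]
    ring

theorem spanPolynomial_succ {w : Fin n → K} (hw : LinearIndependent (ZMod p) w) {j : ℕ}
    (hj : j < n) :
    spanPolynomial (p := p) w (j + 1) = spanPolynomial (p := p) w j ^ p -
      C (eval (w ⟨j, hj⟩) (spanPolynomial (p := p) w j) ^ (p - 1)) *
        spanPolynomial (p := p) w j :=
  spanPolynomial_succ_of_additive hw hj (spanPolynomial_eval_add hw hj.le)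

/-- The recursion of the additive polynomials descends to the field of definition. -/
theorem exists_eq_pow_sub_of_map_eq_spanPolynomial {F : Type*} [Field F] [Fintype F]
    [Algebra F K] {w : Fin n → K} (hw : LinearIndependent (ZMod p) w) {j : ℕ} (hj : j < n)
    (hroot : w ⟨j, hj⟩ ^ Fintype.card F + w ⟨j, hj⟩ = 0) {P P' : F[X]}
    (hP : P.map (algebraMap F K) = spanPolynomial (p := p) w j)
    (hP' : P'.map (algebraMap F K) = spanPolynomial (p := p) w (j + 1)) :
    ∃ c : F, P' = P ^ p - C c * P := by
  have : CharP K p := charP_of_injective_algebraMap (algebraMap (ZMod p) K).injective p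
  have hp : p.Prime := Fact.out
  set Q := spanPolynomial (p := p) w j with hQ
  set y := w ⟨j, hj⟩ with hy
  have hneg : eval (-y) Q = -eval y Q :=
    map_neg (AddMonoidHom.mk' (fun y => eval y Q) (spanPolynomial_eval_add hw hj.le)) y
  have hfrob : eval y Q ^ Fintype.card F = -eval y Q := by
    rw [← hneg, ← eq_neg_of_add_eq_zero_left hroot, ← hP, eval_map_algebraMap,
      eval_map_algebraMap, ← expand_aeval, FiniteField.expand_card, map_pow]
  have hfix : (eval y Q ^ (p - 1)) ^ Fintype.card F = eval y Q ^ (p - 1) := by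
    have h1 : (-1 : K) ^ (p - 1) = 1 := by
      have h2 := neg_one_pow_char K p
      rw [← pow_sub_one_mul hp.ne_zero] at h2
      simpa using h2
    rw [pow_right_comm, hfrob, neg_pow, h1, one_mul]
  obtain ⟨c, hc⟩ := exists_algebraMap_eq_of_pow_card_eq hfix
  refine ⟨c, map_injective _ (algebraMap F K).injective ?_⟩
  rw [hP', spanPolynomial_succ hw hj, Polynomial.map_sub, Polynomial.map_pow,
    Polynomial.map_mul, map_C, hP, hc]

end SpanPolynomial

section TowerStep

variable {F Ω Γ₀ : Type*} [Field F] [Field Ω] [Algebra F Ω]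
  [LinearOrderedCommGroupWithZero Γ₀]

/-- Adjoining a root of `M(T) = y` to `F(S)` when the root is totally ramified. -/
theorem Valuation.IsRational.adjoin_union_singleton {v : Valuation Ω Γ₀} {S : Set Ω} {γ : Γ₀}
    {m e : ℕ} (hγ : 1 < γ) (h : v.IsRational (IntermediateField.adjoin F S) (γ ^ m))
    (hm : 0 < m) (hme : m.Coprime e) {t y : Ω} (ht : v t = γ ^ e) {M : F[X]}
    (hM : M.natDegree = m) (hy : y ∈ IntermediateField.adjoin F S) (hMt : aeval t M = y) :
    v.IsRational (IntermediateField.adjoin F (S ∪ {t})) γ ∧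
      ∃ hle : IntermediateField.adjoin F S ≤ IntermediateField.adjoin F (S ∪ {t}),
        Module.finrank (IntermediateField.adjoin F S)
          (IntermediateField.extendScalars hle) = m := by
  let L := IntermediateField.adjoin F S
  let f : L[X] := M.map (algebraMap F L) - C ⟨y, hy⟩
  have hfm : f.natDegree = m := by rw [natDegree_sub_C, natDegree_map, hM]
  have hf0 : f ≠ 0 := by
    intro h0
    rw [h0, natDegree_zero] at hfm
    exact hm.ne hfm
  have hft : aeval t f = 0 := by
    rw [_root_.map_sub, aeval_map_algebraMap, aeval_C, hMt]
    exact sub_self y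
  obtain ⟨h1, h2⟩ := h.adjoin_root hγ hme ht hf0 hfm hft
  rw [IntermediateField.adjoin_adjoin_left] at h1
  have hle : L ≤ IntermediateField.adjoin F (S ∪ {t}) :=
    IntermediateField.adjoin.mono F _ _ Set.subset_union_left
  refine ⟨h1, hle, ?_⟩
  have heq : IntermediateField.extendScalars hle = IntermediateField.adjoin L {t} :=
    IntermediateField.restrictScalars_injective F (by
      rw [IntermediateField.extendScalars_restrictScalars,
        IntermediateField.adjoin_adjoin_left])
  rw [heq]
  exact h2

/-- Ramification in one step of the Garcia–Stichtenoth tower. -/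
theorem Valuation.garciaStichtenoth_step (v : Valuation Ω Γ₀)
    (hv : ∀ c : F, c ≠ 0 → v (algebraMap F Ω c) = 1) {q : ℕ} (hq : 1 < q) {x z : Ω}
    (hx : 1 < v x) (hzx : z ^ q + z = x ^ (q + 1)) :
    1 < v (z / x) ∧ v x = v (z / x) ^ q ∧ v z = v (z / x) ^ (q + 1) := by
  have hx0 : v x ≠ 0 := (zero_lt_one.trans hx).ne'
  have hz : 1 < v z := by
    by_contra! hz
    have h1 : v (z ^ q + z) ≤ 1 := v.map_add_le (by rw [map_pow]; exact pow_le_one₀ zero_le hz) hz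
    rw [hzx, map_pow] at h1
    exact h1.not_gt (one_lt_pow₀ hx (Nat.succ_ne_zero q))
  have hdeg : (X ^ q + X : F[X]).natDegree = q := by
    rw [natDegree_add_eq_left_of_natDegree_lt] <;> simp [hq]
  have hpow : v z ^ q = v x ^ (q + 1) := by
    have h1 := v.aeval_eq_pow_natDegree hv hz (X ^ q + X : F[X]) (by
      intro h0
      rw [h0, natDegree_zero] at hdeg
      omega)
    rw [hdeg] at h1
    rw [← h1, ← map_pow, ← hzx]
    simp
  have h1 : v x = v (z / x) ^ q := by
    rw [map_div₀, div_pow, hpow, pow_succ, mul_div_cancel_left₀ _ (pow_ne_zero _ hx0)]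
  refine ⟨?_, h1, ?_⟩
  · by_contra! h2
    rw [h1] at hx
    exact hx.not_ge (pow_le_one₀ zero_le h2)
  · rw [pow_succ, ← h1, map_div₀, mul_div_cancel₀ _ hx0]

theorem Valuation.IsRational.notMem {v : Valuation Ω Γ₀} {L : IntermediateField F Ω} {γ : Γ₀}
    {p q d : ℕ} (hp : p.Prime) (hpq : p ∣ q) (hγ : 1 < γ) (h : v.IsRational L (γ ^ p ^ (d + 1)))
    {t : Ω} (ht : v t = γ ^ ((q + 1) * p ^ d)) : t ∉ L := by
  intro hmem
  have hγ0 : γ ≠ 0 := (zero_lt_one.trans hγ).ne'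
  obtain ⟨k, hk⟩ := h.exists_zpow t hmem (by
    rintro rfl
    rw [map_zero] at ht
    exact pow_ne_zero _ hγ0 ht.symm)
  rw [ht, ← zpow_natCast, ← zpow_natCast, ← zpow_mul] at hk
  have h1 := (zpow_right_strictMono₀ hγ).injective hk
  have h2 : ((q + 1 : ℕ) : ℤ) = p * k := by
    have hpd : (p ^ d : ℤ) ≠ 0 := pow_ne_zero _ (by exact_mod_cast hp.ne_zero)
    apply mul_right_cancel₀ hpd
    push_cast at h1 ⊢
    rw [h1]
    ring
  have h3 : p ∣ q + 1 := Int.natCast_dvd_natCast.1 ⟨k, h2⟩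
  exact hp.one_lt.ne' (Nat.dvd_one.1 ((Nat.dvd_add_right hpq).1 h3))

end TowerStep

/-- `q = p^n`. Let `(F_i)` be the Garcia–Stichtenoth tower over
`F_{q²}`: `F₁ = F_{q²}(x₁)`, `F_{i+1} = F_i(z_{i+1})` with `z_{i+1}^q + z_{i+1} = x_i^{q+1}`
and `x_i = z_i/x_{i-1}` (`i ≥ 2`), all realized inside an ambient field `Ω`. Then the
descent of the definition field of the completed tower from `F_{q²}` to `F_q` is
possible: the tower `(G_{i,s})` over `F_q` given by `G_{1,0} = F_q(x₁)`,
`G_{i+1,0} = G_{i,0}(z_{i+1})`, and `G_{i,s} = G_{i,0}(t_{i,s})` with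
`t_{i,s} = P_{n-s}(z_{i+1})` (so `M_{n-s}(t_{i,s}) = x_i^{q+1}`) consists of function
fields with full constant field `F_q`, satisfies
`G_{i,0} ⊂ G_{i,1} ⊂ ⋯ ⊂ G_{i,n-1} ⊂ G_{i+1,0}`, `[G_{i,s} : G_{i,0}] = p^s`, and the
constant field extensions `F_{i,s} = G_{i,s} ⊗_{F_q} F_{q²}` are the steps of the
completed Garcia–Stichtenoth tower (with `F_{i,0} = F_i`). -/
theorem stmt_12
    (p n : ℕ) (hp : p.Prime) (hn : 0 < n) (q : ℕ) (hq : q = p ^ n)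
    (Fq Fq2 : Type) [Field Fq] [Fintype Fq] [Field Fq2] [Fintype Fq2]
    [Algebra Fq Fq2] [Algebra (ZMod p) Fq2]
    (hcardq : Fintype.card Fq = q) (hcardq2 : Fintype.card Fq2 = q ^ 2)
    -- `(w₁,…,w_n)` is an `F_p`-basis of the root set `𝒫` of `T^q + T`
    (w : Fin n → Fq2) (hwroot : ∀ i, (w i) ^ q + w i = 0)
    (hwind : LinearIndependent (ZMod p) w)
    (hwspan : (Submodule.span (ZMod p) (Set.range w) : Set Fq2) =
      {α : Fq2 | α ^ q + α = 0})
    -- the associated `p`-polynomials `P_j` and `M_j` over `F_q`, with `P = M_j ⋆ P_j`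
    (Pi Mi : ℕ → Polynomial Fq)
    (hPi : ∀ j : ℕ, 1 ≤ j → j < n → (Pi j).map (algebraMap Fq Fq2) =
      ∏ a ∈ (Set.toFinite ((Submodule.span (ZMod p) (w '' {l : Fin n | (l : ℕ) < j}) :
        Submodule (ZMod p) Fq2) : Set Fq2)).toFinset, (X - C a))
    (hMiPi : ∀ j : ℕ, 1 ≤ j → j < n → (X ^ q + X : Polynomial Fq) = (Mi j).comp (Pi j))
    -- the Garcia–Stichtenoth tower, realized inside an ambient field `Ω`
    (Ω : Type) [Field Ω] [Algebra Fq2 Ω] [Algebra Fq Ω] [IsScalarTower Fq Fq2 Ω]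
    (x z : ℕ → Ω)
    (hx1 : Transcendental Fq2 (x 1))
    (hzx : ∀ i : ℕ, 1 ≤ i → (z (i + 1)) ^ q + z (i + 1) = (x i) ^ (q + 1))
    (hxi : ∀ i : ℕ, 2 ≤ i → x i = z i / x (i - 1))
    -- the steps of the completed tower over `F_{q²}` and of the reduced tower over `F_q`
    (Fis : ℕ → ℕ → IntermediateField Fq2 Ω)
    (hFis : ∀ i s : ℕ, Fis i s = IntermediateField.adjoin Fq2
      (({x 1} ∪ z '' {j : ℕ | 2 ≤ j ∧ j ≤ i}) ∪
        (if s = 0 then ∅ else {Polynomial.aeval (z (i + 1)) (Pi (n - s))})))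
    (Gis : ℕ → ℕ → IntermediateField Fq Ω)
    (hGis : ∀ i s : ℕ, Gis i s = IntermediateField.adjoin Fq
      (({x 1} ∪ z '' {j : ℕ | 2 ≤ j ∧ j ≤ i}) ∪
        (if s = 0 then ∅ else {Polynomial.aeval (z (i + 1)) (Pi (n - s))}))) :
    ∀ i : ℕ, 1 ≤ i →
      -- each `G_{i,s}` has full constant field `F_q`
      (∀ s : ℕ, s < n → ∀ y : Ω, y ∈ Gis i s → IsAlgebraic Fq y →
        ∃ c : Fq, algebraMap Fq Ω c = y) ∧
      -- `G_{i,0} ⊂ G_{i,1} ⊂ ⋯ ⊂ G_{i,n-1} ⊂ G_{i+1,0}`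
      (∀ s : ℕ, s + 1 < n → Gis i s < Gis i (s + 1)) ∧
      Gis i (n - 1) < Gis (i + 1) 0 ∧
      -- `[G_{i,s} : G_{i,0}] = p^s`
      (∀ s : ℕ, s < n → ∃ h : Gis i 0 ≤ Gis i s,
        Module.finrank (↥(Gis i 0)) (↥(IntermediateField.extendScalars h)) = p ^ s) ∧
      -- `M_{n-s}(t_{i,s}) = x_i^{q+1}`
      (∀ s : ℕ, 1 ≤ s → s < n →
        Polynomial.aeval (Polynomial.aeval (z (i + 1)) (Pi (n - s))) (Mi (n - s)) =
          (x i) ^ (q + 1)) ∧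
      -- `F_{i,s} = G_{i,s} ⊗_{F_q} F_{q²}`: the constant field extension of `G_{i,s}`
      -- is the corresponding step of the completed Garcia–Stichtenoth tower
      (∀ s : ℕ, s < n →
        Nonempty ((↥(Fis i s)) ≃ₐ[Fq] TensorProduct Fq (↥(Gis i s)) Fq2)) := by
  have : Fact p.Prime := ⟨hp⟩
  have hpq : p ∣ q := hq ▸ dvd_pow_self p hn.ne'
  have hq1 : 1 < q := hq ▸ Nat.one_lt_pow hn.ne' hp.one_lt
  obtain ⟨A, hA1, hv2⟩ := exists_valuation_one_lt_of_transcendental hx1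
  generalize A.valuation = v at hA1 hv2
  have hv : ∀ c : Fq, c ≠ 0 → v (algebraMap Fq Ω c) = 1 := fun c hc => by
    rw [IsScalarTower.algebraMap_apply Fq Fq2 Ω]
    exact hv2 _ (by simpa using hc)
  have hXq : (X ^ q + X : Fq[X]).natDegree = q := by
    rw [natDegree_add_eq_left_of_natDegree_lt] <;> simp [hq1]
  have hcop : ∀ s, (p ^ s).Coprime (q + 1) := fun s =>
    Nat.Coprime.pow_left s
      ((Nat.coprime_self_add_right.2 (Nat.coprime_one_right q)).coprime_dvd_left hpq)
  set S : ℕ → Set Ω := fun i => {x 1} ∪ z '' {j : ℕ | 2 ≤ j ∧ j ≤ i} with hS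
  have hG0 : ∀ i, Gis i 0 = IntermediateField.adjoin Fq (S i) := fun i => by
    rw [hGis, if_pos rfl, Set.union_empty]
  have hGs : ∀ i s, s ≠ 0 → Gis i s =
      IntermediateField.adjoin Fq (S i ∪ {aeval (z (i + 1)) (Pi (n - s))}) := fun i s hs => by
    rw [hGis, if_neg hs]
  have hSsucc : ∀ i, 1 ≤ i → S (i + 1) = S i ∪ {z (i + 1)} := fun i hi => by
    have hset : {j : ℕ | 2 ≤ j ∧ j ≤ i + 1} = {j : ℕ | 2 ≤ j ∧ j ≤ i} ∪ {i + 1} := by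
      ext j
      simp only [Set.mem_ofPred_eq, Set.mem_union, Set.mem_singleton_iff]
      omega
    rw [hS]
    simp only
    rw [hset, Set.image_union, Set.image_singleton, Set.union_assoc]
  have hz_mem : ∀ i, 1 ≤ i → z (i + 1) ∈ Gis (i + 1) 0 := fun i hi => by
    rw [hG0, hSsucc i hi]
    exact IntermediateField.subset_adjoin _ _ (Or.inr rfl)
  have hle0 : ∀ i s, Gis i 0 ≤ Gis i s := fun i s => by
    rw [hG0, hGis]
    exact IntermediateField.adjoin.mono _ _ _ Set.subset_union_left
  have hle1 : ∀ i, 1 ≤ i → Gis i 0 ≤ Gis (i + 1) 0 := fun i hi => by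
    rw [hG0, hG0, hSsucc i hi]
    exact IntermediateField.adjoin.mono _ _ _ Set.subset_union_left
  have hstep : ∀ i, 1 ≤ i → 1 < v (x i) → 1 < v (x (i + 1)) ∧ v (x i) = v (x (i + 1)) ^ q ∧
      v (z (i + 1)) = v (x (i + 1)) ^ (q + 1) := fun i hi hxv => by
    rw [hxi (i + 1) (by omega), Nat.add_sub_cancel]
    exact v.garciaStichtenoth_step hv hq1 hxv (hzx i hi)
  have hbase : ∀ i, 1 ≤ i → 1 < v (x i) ∧ x i ∈ Gis i 0 ∧ v.IsRational (Gis i 0) (v (x i)) := by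
    intro i hi
    induction i, hi using Nat.le_induction with
    | base =>
      have hS1 : S 1 = {x 1} := by
        have hset : {j : ℕ | 2 ≤ j ∧ j ≤ 1} = ∅ := by
          ext j
          simp only [Set.mem_ofPred_eq, Set.mem_empty_iff_false, iff_false]
          omega
        simp [hS, hset]
      rw [hG0, hS1]
      exact ⟨hA1, IntermediateField.mem_adjoin_simple_self _ _,
        v.isRational_adjoin_simple hv hA1⟩
    | succ i hi ih =>
      obtain ⟨hxv, hxm, hrat⟩ := ih
      obtain ⟨hγ, hxγ, hzγ⟩ := hstep i hi hxv
      refine ⟨hγ, ?_, ?_⟩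
      · rw [hxi (i + 1) (by omega), Nat.add_sub_cancel]
        exact div_mem (hz_mem i hi) (hle1 i hi hxm)
      · rw [hG0, hSsucc i hi]
        rw [hG0, hxγ] at hrat
        rw [hG0] at hxm
        exact (hrat.adjoin_union_singleton hγ (by omega) (hq ▸ hcop n) hzγ hXq
          (pow_mem hxm (q + 1)) (by simpa using hzx i hi)).1
  have hPdeg : ∀ j, 1 ≤ j → j < n → (Pi j).natDegree = p ^ j := fun j h1 hj => by
    rw [← natDegree_map (algebraMap Fq Fq2), hPi j h1 hj]
    exact spanPolynomial_natDegree hwind hj.le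
  have hMdeg : ∀ s, 1 ≤ s → s < n → (Mi (n - s)).natDegree = p ^ s := fun s h1 hs => by
    have h2 := congrArg natDegree (hMiPi (n - s) (by omega) (by omega))
    rw [hXq, natDegree_comp, hPdeg (n - s) (by omega) (by omega), hq] at h2
    refine Nat.eq_of_mul_eq_mul_right (pow_pos hp.pos (n - s)) ?_
    rw [← h2, ← pow_add]
    congr 1
    omega
  intro i hi
  obtain ⟨hxv, hxm, hrat⟩ := hbase i hi
  obtain ⟨hγ, hxγ, hzγ⟩ := hstep i hi hxv
  set γ := v (x (i + 1)) with hγdef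
  have hz1 : 1 < v (z (i + 1)) := hzγ ▸ one_lt_pow₀ hγ (Nat.succ_ne_zero q)
  have hMt : ∀ s : ℕ, 1 ≤ s → s < n →
      aeval (aeval (z (i + 1)) (Pi (n - s))) (Mi (n - s)) = (x i) ^ (q + 1) := fun s h1 hs => by
    rw [← aeval_comp, ← hMiPi (n - s) (by omega) (by omega), ← hzx i hi]
    simp
  have htv : ∀ s : ℕ, 1 ≤ s → s < n →
      v (aeval (z (i + 1)) (Pi (n - s))) = γ ^ ((q + 1) * p ^ (n - s)) := fun s h1 hs => by
    have hdeg := hPdeg (n - s) (by omega) (by omega)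
    rw [v.aeval_eq_pow_natDegree hv hz1, hdeg, hzγ, ← pow_mul]
    intro h0
    rw [h0, natDegree_zero] at hdeg
    exact (pow_pos hp.pos (n - s)).ne hdeg
  have hlayer : ∀ s : ℕ, s < n → v.IsRational (Gis i s) (γ ^ p ^ (n - s)) ∧
      ∃ h : Gis i 0 ≤ Gis i s,
        Module.finrank (Gis i 0) (IntermediateField.extendScalars h) = p ^ s := by
    intro s hs
    rcases Nat.eq_zero_or_pos s with rfl | h1
    · refine ⟨by rwa [Nat.sub_zero, ← hq, ← hxγ], le_rfl, ?_⟩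
      rw [IntermediateField.extendScalars_self, IntermediateField.finrank_bot, pow_zero]
    · rw [hG0, hxγ, hq, ← Nat.sub_add_cancel hs.le, pow_add, pow_mul] at hrat
      rw [hG0] at hxm
      rw [hG0, hGs i s (by omega)]
      refine hrat.adjoin_union_singleton (one_lt_pow₀ hγ (pow_pos hp.pos _).ne')
        (pow_pos hp.pos s) (hcop s) ?_ (hMdeg s h1 hs) (pow_mem hxm (q + 1)) (hMt s h1 hs)
      rw [htv s h1 hs, ← pow_mul, mul_comm]
  refine ⟨fun s hs y hy hy' => (hlayer s hs).1.exists_algebraMap_eq hv hy hy', ?_, ?_,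
    fun s hs => (hlayer s hs).2, hMt, ?_⟩
  · intro s hs
    have hmem : aeval (z (i + 1)) (Pi (n - (s + 1))) ∈ Gis i (s + 1) := by
      rw [hGs i (s + 1) (by omega)]
      exact IntermediateField.subset_adjoin _ _ (Or.inr rfl)
    refine lt_of_le_of_ne ?_ fun heq => ?_
    · rcases Nat.eq_zero_or_pos s with rfl | h1
      · exact hle0 i 1
      have hns : n - s = n - (s + 1) + 1 := by omega
      obtain ⟨c, hc⟩ := exists_eq_pow_sub_of_map_eq_spanPolynomial hwind
        (j := n - (s + 1)) (by omega) (hcardq ▸ hwroot _)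
        (hPi (n - (s + 1)) (by omega) (by omega))
        (hPi (n - (s + 1) + 1) (by omega) (by omega))
      rw [hGs i s (by omega), IntermediateField.adjoin_le_iff]
      rintro y (hy | rfl)
      · exact hle0 i (s + 1) (hG0 i ▸ IntermediateField.subset_adjoin _ _ hy)
      · rw [hns, hc, map_sub, map_mul, map_pow, aeval_C]
        exact sub_mem (pow_mem hmem p)
          (mul_mem (IntermediateField.algebraMap_mem _ c) hmem)
    · have hrat' := (hlayer s (by omega)).1
      rw [show n - s = n - (s + 1) + 1 by omega] at hrat'
      exact hrat'.notMem hp hpq hγ (htv (s + 1) (by omega) hs) (heq ▸ hmem)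
  · refine lt_of_le_of_ne ?_ fun heq => ?_
    · rw [hGis, IntermediateField.adjoin_le_iff]
      rintro y (hy | hy)
      · exact hle1 i hi (hG0 i ▸ IntermediateField.subset_adjoin _ _ hy)
      · split_ifs at hy
        · exact hy.elim
        · obtain rfl := hy
          rw [aeval_eq_sum_range]
          exact sum_mem fun k _ => (Gis (i + 1) 0).smul_mem (pow_mem (hz_mem i hi) k)
    · have hrat' := (hlayer (n - 1) (by omega)).1
      rw [show n - (n - 1) = 0 + 1 by omega] at hrat'
      exact hrat'.notMem hp hpq hγ (by rw [hzγ, pow_zero, mul_one]) (heq ▸ hz_mem i hi)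
  · intro s hs
    have hrat' := (hlayer s hs).1
    rw [hGis] at hrat'
    rw [hFis, hGis]
    exact hrat'.nonempty_algEquiv_tensorProduct hv2
end
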